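/- Let F be an SWF on a domain D ∈ 𝒟^PT ∩ 𝒟^DT satisfying unanimity and IIA. If G and G' are two coalitions that are almost-decisive w.r.t. F, then the coalition G ∩ G' is almost-decisive w.r.t. F. -/

import Mathlib

open Set
namespace ArrowSC

/-- A profile assigns to each voter a binary relation (their preference) on alternatives. -/
abbrev Profile (n : ℕ) (X : Type*) := Fin n → X → X → Prop

/-- `r` is a strict total order. -/
def IsSTO {X : Type*} (r : X → X → Prop) : Prop :=
  (∀ x, ¬ r x x) ∧ (∀ x y z, r x y → r y z → r x z) ∧
  (∀ x y, x ≠ y → r x y ∨ r y x)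

/-- A genuine profile: every voter's relation is a strict total order, i.e. a member of W(X)^n. -/
def IsProfile {n : ℕ} {X : Type*} (P : Profile n X) : Prop := ∀ i, IsSTO (P i)

/-- A domain: a nonempty set of profiles, each a member of W(X)^n. -/
def IsDomain {n : ℕ} {X : Type*} (D : Set (Profile n X)) : Prop :=
  D.Nonempty ∧ ∀ P ∈ D, IsProfile P

/-- `F` is a social welfare function on `D`: it sends each profile in `D` to a strict total order. -/
def IsSWF {n : ℕ} {X : Type*} (D : Set (Profile n X))
    (F : Profile n X → X → X → Prop) : Prop :=
  ∀ P ∈ D, IsSTO (F P)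

def Unanimity {n : ℕ} {X : Type*} (D : Set (Profile n X))
    (F : Profile n X → X → X → Prop) : Prop :=
  ∀ P ∈ D, ∀ a b : X, (∀ i, P i a b) → F P a b

def IIA {n : ℕ} {X : Type*} (D : Set (Profile n X))
    (F : Profile n X → X → X → Prop) : Prop :=
  ∀ P ∈ D, ∀ P' ∈ D, ∀ a b : X, (∀ i, P i a b ↔ P' i a b) → (F P a b ↔ F P' a b)

def IsDictator {n : ℕ} {X : Type*} (D : Set (Profile n X))
    (F : Profile n X → X → X → Prop) (d : Fin n) : Prop :=
  ∀ P ∈ D, ∀ a b : X, P d a b → F P a b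

def Dictatorial {n : ℕ} {X : Type*} (D : Set (Profile n X))
    (F : Profile n X → X → X → Prop) : Prop :=
  ∃ d, IsDictator D F d

/-- Coalition `G` is almost-decisive over the ordered pair `(a, b)` w.r.t. `F`. -/
def AlmostDecisivePair {n : ℕ} {X : Type*} (D : Set (Profile n X))
    (F : Profile n X → X → X → Prop) (G : Set (Fin n)) (a b : X) : Prop :=
  ∀ P ∈ D, (∀ i, P i a b ↔ i ∈ G) → F P a b

/-- Coalition `G` is almost-decisive over `Y` w.r.t. `F`. -/
def AlmostDecisiveOn {n : ℕ} {X : Type*} (D : Set (Profile n X))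
    (F : Profile n X → X → X → Prop) (G : Set (Fin n)) (Y : Set X) : Prop :=
  ∀ a ∈ Y, ∀ b ∈ Y, a ≠ b → AlmostDecisivePair D F G a b

/-- Coalition `G` is almost-decisive (over all of X) w.r.t. `F`. -/
def AlmostDecisive {n : ℕ} {X : Type*} (D : Set (Profile n X))
    (F : Profile n X → X → X → Prop) (G : Set (Fin n)) : Prop :=
  ∀ a b : X, a ≠ b → AlmostDecisivePair D F G a b

/-- The restriction of `r` to the triple `{a,b,c}` is the order `a` above `b` above `c`. -/
def RanksTriple {X : Type*} (r : X → X → Prop) (a b c : X) : Prop :=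
  r a b ∧ r b c ∧ r a c

/-- The polarized profile `(G : abc, Gᶜ : a'b'c')` on a triple is a subprofile of `D`,
i.e. it belongs to the restriction `D|_{triple}`. -/
def HasPolarizedSubprofile {n : ℕ} {X : Type*} (D : Set (Profile n X)) (G : Set (Fin n))
    (a b c a' b' c' : X) : Prop :=
  ∃ P ∈ D, ∀ i, (i ∈ G → RanksTriple (P i) a b c) ∧ (i ∉ G → RanksTriple (P i) a' b' c')

/-- `D_1(G, {a,b,c}) ⊆ D|_{{a,b,c}}`. -/
def D1sub {n : ℕ} {X : Type*} (D : Set (Profile n X)) (G : Set (Fin n)) (a b c : X) : Prop :=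
  HasPolarizedSubprofile D G b c a a b c ∧
  HasPolarizedSubprofile D G b a c a c b ∧
  HasPolarizedSubprofile D G a b c c a b ∧
  HasPolarizedSubprofile D G a c b c b a ∧
  HasPolarizedSubprofile D G c a b b c a ∧
  HasPolarizedSubprofile D G c b a b a c

/-- `D_2(G, {a,b,c}) ⊆ D|_{{a,b,c}}`. -/
def D2sub {n : ℕ} {X : Type*} (D : Set (Profile n X)) (G : Set (Fin n)) (a b c : X) : Prop :=
  HasPolarizedSubprofile D G a b c b c a ∧
  HasPolarizedSubprofile D G a c b b a c ∧
  HasPolarizedSubprofile D G c a b a b c ∧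
  HasPolarizedSubprofile D G c b a a c b ∧
  HasPolarizedSubprofile D G b c a c a b ∧
  HasPolarizedSubprofile D G b a c c b a

/-- The class 𝒟^PT of polarization over triples. -/
def ClassPT {n : ℕ} {X : Type*} (D : Set (Profile n X)) : Prop :=
  ∀ G : Set (Fin n), G ≠ ∅ → G ≠ univ →
    ∀ a b c : X, a ≠ b → b ≠ c → a ≠ c →
      D1sub D G a b c ∨ D2sub D G a b c

/-- The class 𝒟^DT of diversity over triples. -/
def ClassDT {n : ℕ} {X : Type*} (D : Set (Profile n X)) : Prop :=
  ∀ G G' : Set (Fin n), ¬ G ⊆ G' → ¬ G' ⊆ G →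
    ∃ a b c : X, a ≠ b ∧ b ≠ c ∧ a ≠ c ∧ ∃ P ∈ D, ∀ i,
      (P i a b ↔ i ∈ G) ∧ (P i b c ↔ i ∈ G') ∧ (P i c a ↔ i ∉ G ∩ G')

/-- `D` is Arrow-inconsistent. -/
def ArrowInconsistent {n : ℕ} {X : Type*} (D : Set (Profile n X)) : Prop :=
  ∀ F : Profile n X → X → X → Prop,
    IsSWF D F → Unanimity D F → IIA D F → Dictatorial D F

/-- `a` is the most-preferred among `{a,b,c}` according to `r`. -/
def TripleBest {X : Type*} (r : X → X → Prop) (a b c : X) : Prop := r a b ∧ r a c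

/-- `a` is the least-preferred among `{a,b,c}` according to `r`. -/
def TripleWorst {X : Type*} (r : X → X → Prop) (a b c : X) : Prop := r b a ∧ r c a

/-- `a` is the middle-preferred among `{a,b,c}` according to `r`. -/
def TripleMiddle {X : Type*} (r : X → X → Prop) (a b c : X) : Prop :=
  (r b a ∧ r a c) ∨ (r c a ∧ r a b)

/-- In profile `P`, alternative `a` is never placed as the most-preferred, or never as the
middle-preferred, or never as the least-preferred alternative among `{a,b,c}`. -/
def NeverBMW {n : ℕ} {X : Type*} (P : Profile n X) (a b c : X) : Prop :=
  (∀ i, ¬ TripleBest (P i) a b c) ∨ (∀ i, ¬ TripleMiddle (P i) a b c) ∨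
  (∀ i, ¬ TripleWorst (P i) a b c)

/-- Sen's value-restriction of a profile over `Y`. -/
def ValueRestricted {n : ℕ} {X : Type*} (P : Profile n X) (Y : Set X) : Prop :=
  ∀ a ∈ Y, ∀ b ∈ Y, ∀ c ∈ Y, a ≠ b → b ≠ c → a ≠ c →
    NeverBMW P a b c ∨ NeverBMW P b a c ∨ NeverBMW P c a b

/-- The strict total order on the triple `{a,b,c}` ranking `a` above `b` above `c`,
viewed as a relation with support in `{a,b,c}`. -/
def seqOrder {X : Type*} (a b c : X) : X → X → Prop :=
  fun x y => (x = a ∧ y = b) ∨ (x = b ∧ y = c) ∨ (x = a ∧ y = c)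

/-- `r` is a strict total order on the triple `{a,b,c}` (with support in the triple). -/
def IsTripleOrder {X : Type*} (a b c : X) (r : X → X → Prop) : Prop :=
  (∀ x y, r x y → x ∈ ({a, b, c} : Set X) ∧ y ∈ ({a, b, c} : Set X)) ∧
  (∀ x, ¬ r x x) ∧ (∀ x y z, r x y → r y z → r x z) ∧
  (∀ x ∈ ({a, b, c} : Set X), ∀ y ∈ ({a, b, c} : Set X), x ≠ y → r x y ∨ r y x)

/-- The polarized profile `(G : Q, Gᶜ : Q')`. -/
def polarizedProfile {n : ℕ} {X : Type*} (G : Set (Fin n)) (Q Q' : X → X → Prop) :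
    Profile n X :=
  fun i x y => (i ∈ G ∧ Q x y) ∨ (i ∉ G ∧ Q' x y)

/-- `Q` and `Q'` differ on how they rank the pair `{x, y}`. -/
def DifferOn {X : Type*} (Q Q' : X → X → Prop) (x y : X) : Prop := ¬ (Q x y ↔ Q' x y)

/-- `Q` and `Q'` differ on exactly two of the three unordered pairs of the triple `{a,b,c}`
and coincide on the remaining pair. -/
def StronglyPolarizedPair {X : Type*} (a b c : X) (Q Q' : X → X → Prop) : Prop :=
  (DifferOn Q Q' a b ∧ DifferOn Q Q' b c ∧ ¬ DifferOn Q Q' a c) ∨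
  (DifferOn Q Q' a b ∧ ¬ DifferOn Q Q' b c ∧ DifferOn Q Q' a c) ∨
  (¬ DifferOn Q Q' a b ∧ DifferOn Q Q' b c ∧ DifferOn Q Q' a c)

/-- The set `D_1(G, {a,b,c})` of polarized profiles on the triple `{a,b,c}`. -/
def D1set {n : ℕ} {X : Type*} (G : Set (Fin n)) (a b c : X) : Set (Profile n X) :=
  { polarizedProfile G (seqOrder b c a) (seqOrder a b c),
    polarizedProfile G (seqOrder b a c) (seqOrder a c b),
    polarizedProfile G (seqOrder a b c) (seqOrder c a b),
    polarizedProfile G (seqOrder a c b) (seqOrder c b a),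
    polarizedProfile G (seqOrder c a b) (seqOrder b c a),
    polarizedProfile G (seqOrder c b a) (seqOrder b a c) }

/-- The set `D_2(G, {a,b,c})` of polarized profiles on the triple `{a,b,c}`. -/
def D2set {n : ℕ} {X : Type*} (G : Set (Fin n)) (a b c : X) : Set (Profile n X) :=
  { polarizedProfile G (seqOrder a b c) (seqOrder b c a),
    polarizedProfile G (seqOrder a c b) (seqOrder b a c),
    polarizedProfile G (seqOrder c a b) (seqOrder a b c),
    polarizedProfile G (seqOrder c b a) (seqOrder a c b),
    polarizedProfile G (seqOrder b c a) (seqOrder c a b),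
    polarizedProfile G (seqOrder b a c) (seqOrder c b a) }

/-- The set of all strongly polarized profiles on the triple `{a,b,c}`
of the form `(G : Q, Gᶜ : Q')`. -/
def SPset {n : ℕ} {X : Type*} (G : Set (Fin n)) (a b c : X) : Set (Profile n X) :=
  { p | ∃ Q Q', IsTripleOrder a b c Q ∧ IsTripleOrder a b c Q' ∧
      StronglyPolarizedPair a b c Q Q' ∧ p = polarizedProfile G Q Q' }
/-- Every value of `F` on the pair `(a, b)` is determined, by IIA, by a single profile at which
exactly the members of `G` rank `a` above `b`. -/
lemma AlmostDecisivePair.of_profile {n : ℕ} {X : Type*} {D : Set (Profile n X)}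
    {F : Profile n X → X → X → Prop} (hIIA : IIA D F) {G : Set (Fin n)} {a b : X}
    {P : Profile n X} (hP : P ∈ D) (hab : ∀ i, P i a b ↔ i ∈ G) (hFP : F P a b) :
    AlmostDecisivePair D F G a b := fun Q hQ hQab =>
  (hIIA P hP Q hQ a b fun i => (hab i).trans (hQab i).symm).1 hFP

lemma IsSTO.asymm {X : Type*} {r : X → X → Prop} (hr : IsSTO r) {a b : X} (h : r a b) :
    ¬ r b a := fun h' => hr.1 a (hr.2.1 a b a h h')

section Contagion

variable {n : ℕ} {X : Type*} {D : Set (Profile n X)} {F : Profile n X → X → X → Prop}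
  {G : Set (Fin n)} {a b c : X}

/-- Almost-decisiveness passes from `(a, b)` to `(a, c)` along the profile `(G : abc, Gᶜ : bca)`. -/
lemma AlmostDecisivePair.lower_right (hD : IsDomain D) (hF : IsSWF D F) (hU : Unanimity D F)
    (hIIA : IIA D F) (hP : HasPolarizedSubprofile D G a b c b c a)
    (h : AlmostDecisivePair D F G a b) : AlmostDecisivePair D F G a c := by
  obtain ⟨P, hPD, hP⟩ := hP
  have hab : ∀ i, P i a b ↔ i ∈ G := fun i =>
    ⟨fun hi => by_contra fun hG => (hD.2 P hPD i).asymm hi ((hP i).2 hG).2.2,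
      fun hG => ((hP i).1 hG).1⟩
  have hac : ∀ i, P i a c ↔ i ∈ G := fun i =>
    ⟨fun hi => by_contra fun hG => (hD.2 P hPD i).asymm hi ((hP i).2 hG).2.1,
      fun hG => ((hP i).1 hG).2.2⟩
  have hbc : ∀ i, P i b c := fun i => by
    by_cases hG : i ∈ G
    · exact ((hP i).1 hG).2.1
    · exact ((hP i).2 hG).1
  exact .of_profile hIIA hPD hac
    ((hF P hPD).2.1 a b c (h P hPD hab) (hU P hPD b c hbc))

/-- Almost-decisiveness passes from `(b, c)` to `(a, c)` along the profile `(G : abc, Gᶜ : cab)`. -/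
lemma AlmostDecisivePair.raise_left (hD : IsDomain D) (hF : IsSWF D F) (hU : Unanimity D F)
    (hIIA : IIA D F) (hP : HasPolarizedSubprofile D G a b c c a b)
    (h : AlmostDecisivePair D F G b c) : AlmostDecisivePair D F G a c := by
  obtain ⟨P, hPD, hP⟩ := hP
  have hbc : ∀ i, P i b c ↔ i ∈ G := fun i =>
    ⟨fun hi => by_contra fun hG => (hD.2 P hPD i).asymm hi ((hP i).2 hG).2.2,
      fun hG => ((hP i).1 hG).2.1⟩
  have hac : ∀ i, P i a c ↔ i ∈ G := fun i =>
    ⟨fun hi => by_contra fun hG => (hD.2 P hPD i).asymm hi ((hP i).2 hG).1,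
      fun hG => ((hP i).1 hG).2.2⟩
  have hab : ∀ i, P i a b := fun i => by
    by_cases hG : i ∈ G
    · exact ((hP i).1 hG).1
    · exact ((hP i).2 hG).2.1
  exact .of_profile hIIA hPD hac
    ((hF P hPD).2.1 a b c (hU P hPD a b hab) (h P hPD hbc))

/-- On a triple, almost-decisiveness over one ordered pair spreads to the pairs `(a, c)`, `(c, a)`,
`(b, a)`. -/
lemma AlmostDecisivePair.spread (hD : IsDomain D) (hF : IsSWF D F) (hU : Unanimity D F)
    (hIIA : IIA D F) (hPT : D1sub D G a b c ∨ D2sub D G a b c)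
    (h : AlmostDecisivePair D F G a b) :
    AlmostDecisivePair D F G a c ∧ AlmostDecisivePair D F G c a ∧
      AlmostDecisivePair D F G b a := by
  rcases hPT with ⟨h₁, h₂, h₃, -, h₅, h₆⟩ | ⟨h₁, -, h₃, h₄, h₅, h₆⟩
  · have hcb := h.raise_left hD hF hU hIIA h₅
    have hca := hcb.lower_right hD hF hU hIIA h₆
    have hba := hca.raise_left hD hF hU hIIA h₁
    have hbc := hba.lower_right hD hF hU hIIA h₂
    exact ⟨hbc.raise_left hD hF hU hIIA h₃, hca, hba⟩
  · have hac := h.lower_right hD hF hU hIIA h₁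
    have hbc := hac.raise_left hD hF hU hIIA h₆
    have hba := hbc.lower_right hD hF hU hIIA h₅
    exact ⟨hac, hba.raise_left hD hF hU hIIA h₄, hba⟩

/-- On a domain with polarization over triples, a proper nonempty coalition that is
almost-decisive over one ordered pair is almost-decisive. -/
lemma AlmostDecisivePair.almostDecisive [Fintype X] (hX : 3 ≤ Fintype.card X)
    (hD : IsDomain D) (hPT : ClassPT D) (hF : IsSWF D F) (hU : Unanimity D F) (hIIA : IIA D F)
    (hne : G ≠ ∅) (huniv : G ≠ univ) (hab : a ≠ b) (h : AlmostDecisivePair D F G a b) :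
    AlmostDecisive D F G := by
  have key : ∀ x y z, x ≠ y → y ≠ z → x ≠ z → AlmostDecisivePair D F G x y →
      AlmostDecisivePair D F G x z ∧ AlmostDecisivePair D F G z x ∧
        AlmostDecisivePair D F G y x := fun x y z hxy hyz hxz hd =>
    hd.spread hD hF hU hIIA (hPT G hne huniv x y z hxy hyz hxz)
  have hswap : ∀ x y, x ≠ y → AlmostDecisivePair D F G x y → AlmostDecisivePair D F G y x := by
    intro x y hxy hd
    obtain ⟨z, hzx, hzy⟩ := ENat.exists_ne_ne_of_three_le (α := X)
      (by simpa using hX) x y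
    exact (key x y z hxy hzy.symm hzx.symm hd).2.2
  have hright : ∀ x y z, x ≠ y → x ≠ z → AlmostDecisivePair D F G x y →
      AlmostDecisivePair D F G x z := by
    intro x y z hxy hxz hd
    by_cases hyz : y = z
    · exact hyz ▸ hd
    · exact (key x y z hxy hyz hxz hd).1
  intro x y hxy
  by_cases hxa : x = a
  · subst hxa
    exact hright x b y hab hxy h
  · exact hright x a y hxa hxy (hswap a x (Ne.symm hxa) (hright a b x hab (Ne.symm hxa) h))

end Contagion

/-- for domains in 𝒟^PT ∩ 𝒟^DT, almost-decisiveness is closed under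
intersection (second ultrafilter property). -/
theorem almost_decisive_inter {X : Type*} [Fintype X] {n : ℕ}
    (hX : 3 ≤ Fintype.card X) (hn : 2 ≤ n)
    (D : Set (Profile n X)) (hD : IsDomain D) (hPT : ClassPT D) (hDT : ClassDT D)
    (F : Profile n X → X → X → Prop) (hF : IsSWF D F)
    (hU : Unanimity D F) (hIIA : IIA D F)
    (G G' : Set (Fin n))
    (hG : AlmostDecisive D F G) (hG' : AlmostDecisive D F G') :
    AlmostDecisive D F (G ∩ G') := by
  by_cases hle : G ⊆ G'
  · rwa [inter_eq_left.2 hle]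
  by_cases hge : G' ⊆ G
  · rwa [inter_eq_right.2 hge]
  obtain ⟨a, b, c, hab, hbc, hac, P, hPD, hP⟩ := hDT G G' hle hge
  have hFac : F P a c := (hF P hPD).2.1 a b c (hG a b hab P hPD fun i => (hP i).1)
    (hG' b c hbc P hPD fun i => (hP i).2.1)
  have hPac : ∀ i, P i a c ↔ i ∈ G ∩ G' := fun i =>
    ⟨fun hi => by_contra fun hmem => (hD.2 P hPD i).asymm hi ((hP i).2.2.2 hmem),
      fun hmem => ((hD.2 P hPD i).2.2 a c hac).resolve_right
        fun hca => (hP i).2.2.1 hca hmem⟩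
  have hne : G ∩ G' ≠ ∅ := fun h0 => (hF P hPD).asymm hFac <|
    hU P hPD c a fun i => (hP i).2.2.2 (by simp [h0])
  have huniv : G ∩ G' ≠ univ := fun h1 => hle fun i _ => (h1.symm ▸ mem_univ i : i ∈ G ∩ G').2
  exact (AlmostDecisivePair.of_profile hIIA hPD hPac hFac).almostDecisive hX hD hPT hF hU hIIA
    hne huniv hac

end ArrowSC
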